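/- Let λ1, λ2 ≥ 0 with λ⁺ = λ1 + λ2 > 0. Define μ_r = Σ_{j=0}^{∞} Σ_{k=0}^{∞} (e^{−λ1/2}(λ1/2)^j/j!)·(e^{−λ2/2}(λ2/2)^k/k!)·(1+j)_r/(2+j+k)_r for r = 1, 2 (the first two moments about zero of the doubly non-central beta distribution with both shape parameters equal to 1 and non-centrality parameters λ1, λ2), and let V = μ_2 − μ_1². Then V = 4/(λ⁺)² + [4λ1λ2/(λ⁺)⁵]·[(λ⁺−2)(λ⁺−8) − 2·e^{−λ⁺/2}·(λ⁺+8)] + [8(λ1−λ2)²/(λ⁺)⁶]·[(λ⁺)²·e^{−λ⁺/2} − 2·(1−e^{−λ⁺/2})·(λ⁺+1−e^{−λ⁺/2})]. -/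

import Mathlib

open scoped Nat

/-- Ascending factorial (Pochhammer symbol) `(a)_n = a(a+1)⋯(a+n-1)` for a real `a`. -/
noncomputable def asc (a : ℝ) (n : ℕ) : ℝ := Polynomial.eval a (ascPochhammer ℝ n)

open Finset in
theorem Summable.tsum_tsum_eq_tsum_sum_antidiagonal {f : ℕ × ℕ → ℝ} (hf : Summable f) :
    ∑' j : ℕ, ∑' k : ℕ, f (j, k) = ∑' n : ℕ, ∑ p ∈ HasAntidiagonal.antidiagonal n, f p := by
  rw [← hf.tsum_prod, ← Finset.HasAntidiagonal.sigmaAntidiagonalEquivProd.tsum_eq f]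
  have hf' : Summable fun x => f (Finset.HasAntidiagonal.sigmaAntidiagonalEquivProd (A := ℕ) x) :=
    Finset.HasAntidiagonal.sigmaAntidiagonalEquivProd.summable_iff.mpr hf
  rw [hf'.tsum_sigma' fun n => (hasSum_fintype _).summable]
  refine tsum_congr fun n => ?_
  rw [tsum_fintype, ← sum_coe_sort (HasAntidiagonal.antidiagonal n)]
  rfl

/-- The binomial theorem with the factorials distributed over the terms. -/
theorem sum_antidiagonal_pow_div_factorial (a b : ℝ) (n : ℕ) :
    ∑ p ∈ Finset.HasAntidiagonal.antidiagonal n, a ^ p.1 / (p.1 ! : ℝ) * (b ^ p.2 / (p.2 ! : ℝ)) =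
      (a + b) ^ n / (n ! : ℝ) := by
  rw [(Commute.all a b).add_pow', Finset.sum_div]
  refine Finset.sum_congr rfl fun p hp => ?_
  rw [Finset.HasAntidiagonal.mem_antidiagonal] at hp
  subst hp
  rw [nsmul_eq_mul, Nat.cast_add_choose]
  field_simp

theorem sum_antidiagonal_mul_pow_div_factorial (a b : ℝ) (hs : a + b ≠ 0) (n : ℕ) :
    ∑ p ∈ Finset.HasAntidiagonal.antidiagonal n, (p.1 : ℝ) * (a ^ p.1 / (p.1 ! : ℝ) * (b ^ p.2 / (p.2 ! : ℝ))) =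
      n * (a / (a + b)) * ((a + b) ^ n / (n ! : ℝ)) := by
  cases n with
  | zero => simp
  | succ n =>
    rw [Finset.Nat.sum_antidiagonal_succ]
    have h : ∀ p : ℕ × ℕ, ((p.1 + 1 : ℕ) : ℝ) *
        (a ^ (p.1 + 1) / ((p.1 + 1)! : ℝ) * (b ^ p.2 / (p.2 ! : ℝ))) =
        a * (a ^ p.1 / (p.1 ! : ℝ) * (b ^ p.2 / (p.2 ! : ℝ))) := fun p => by
      rw [Nat.factorial_succ]
      push_cast
      field_simp
      ring
    simp only [h]
    rw [← Finset.mul_sum, sum_antidiagonal_pow_div_factorial, Nat.factorial_succ]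
    push_cast
    field_simp
    ring

theorem sum_antidiagonal_mul_sub_one_mul_pow_div_factorial (a b : ℝ) (hs : a + b ≠ 0) (n : ℕ) :
    ∑ p ∈ Finset.HasAntidiagonal.antidiagonal n,
        (p.1 : ℝ) * (p.1 - 1) * (a ^ p.1 / (p.1 ! : ℝ) * (b ^ p.2 / (p.2 ! : ℝ))) =
      n * (n - 1) * (a / (a + b)) ^ 2 * ((a + b) ^ n / (n ! : ℝ)) := by
  cases n with
  | zero => simp
  | succ n =>
    rw [Finset.Nat.sum_antidiagonal_succ]
    have h : ∀ p : ℕ × ℕ, ((p.1 + 1 : ℕ) : ℝ) * ((p.1 + 1 : ℕ) - 1) *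
        (a ^ (p.1 + 1) / ((p.1 + 1)! : ℝ) * (b ^ p.2 / (p.2 ! : ℝ))) =
        a * (p.1 * (a ^ p.1 / (p.1 ! : ℝ) * (b ^ p.2 / (p.2 ! : ℝ)))) := fun p => by
      rw [Nat.factorial_succ]
      push_cast
      field_simp
      ring
    simp only [h]
    rw [← Finset.mul_sum, sum_antidiagonal_mul_pow_div_factorial a b hs, Nat.factorial_succ]
    push_cast
    field_simp
    ring

theorem hasSum_pow_add_div_factorial (s : ℝ) (m : ℕ) :
    HasSum (fun n : ℕ => s ^ (n + m) / ((n + m)! : ℝ))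
      (Real.exp s - ∑ i ∈ Finset.range m, s ^ i / (i ! : ℝ)) := by
  have h := NormedSpace.expSeries_div_hasSum_exp (𝔸 := ℝ) s
  rw [← Real.exp_eq_exp_ℝ] at h
  exact (hasSum_nat_add_iff' m).mpr h

/-- An expectation of a bounded weight under two independent Poisson laws, grouped by the
total count. -/
theorem tsum_tsum_poisson_mul (a b : ℝ) (ha : 0 ≤ a) (hb : 0 ≤ b) (q : ℕ → ℕ → ℝ)
    (hq0 : ∀ j k, 0 ≤ q j k) (hq1 : ∀ j k, q j k ≤ 1) :
    ∑' j : ℕ, ∑' k : ℕ, (Real.exp (-a) * a ^ j / (j ! : ℝ)) *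
        (Real.exp (-b) * b ^ k / (k ! : ℝ)) * q j k =
      Real.exp (-(a + b)) * ∑' n : ℕ, ∑ p ∈ Finset.HasAntidiagonal.antidiagonal n,
        q p.1 p.2 * (a ^ p.1 / (p.1 ! : ℝ) * (b ^ p.2 / (p.2 ! : ℝ))) := by
  have hsum : Summable fun p : ℕ × ℕ =>
      q p.1 p.2 * (a ^ p.1 / (p.1 ! : ℝ) * (b ^ p.2 / (p.2 ! : ℝ))) := by
    have hw : Summable fun p : ℕ × ℕ => a ^ p.1 / (p.1 ! : ℝ) * (b ^ p.2 / (p.2 ! : ℝ)) :=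
      (Real.summable_pow_div_factorial a).mul_of_nonneg (Real.summable_pow_div_factorial b)
        (fun _ => by positivity) (fun _ => by positivity)
    refine Summable.of_nonneg_of_le (fun p => mul_nonneg (hq0 _ _) (by positivity))
      (fun p => mul_le_of_le_one_left (by positivity) (hq1 _ _)) hw
  rw [← hsum.tsum_tsum_eq_tsum_sum_antidiagonal, ← tsum_mul_left]
  refine tsum_congr fun j => ?_
  rw [← tsum_mul_left]
  refine tsum_congr fun k => ?_
  rw [neg_add, Real.exp_add]
  ring

theorem asc_one (x : ℝ) : asc x 1 = x := by
  simp [asc]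

theorem asc_two (x : ℝ) : asc x 2 = x * (x + 1) := by
  simp [asc, ascPochhammer_succ_eval]

theorem dncBeta_one_one_first_moment (a b : ℝ) (ha : 0 ≤ a) (hb : 0 ≤ b) (hs : 0 < a + b) :
    ∑' j : ℕ, ∑' k : ℕ, (Real.exp (-a) * a ^ j / (j ! : ℝ)) *
        (Real.exp (-b) * b ^ k / (k ! : ℝ)) * (asc (1 + j) 1 / asc (2 + j + k) 1) =
      Real.exp (-(a + b)) *
        ((Real.exp (a + b) - 1 - (a + b)) * (-1 / (a + b) ^ 2 + 2 * a / (a + b) ^ 3) +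
          (Real.exp (a + b) - 1) * (1 / (a + b) - 2 * a / (a + b) ^ 2) +
          Real.exp (a + b) * (a / (a + b))) := by
  simp only [asc_one]
  rw [tsum_tsum_poisson_mul a b ha hb (fun j k => (1 + j : ℝ) / (2 + j + k))
    (fun j k => by positivity)
    (fun j k => by
      rw [div_le_one (by positivity)]
      have := Nat.cast_nonneg (α := ℝ) k
      linarith)]
  congr 1
  have h0 := hasSum_pow_add_div_factorial (a + b) 0
  have h1 := hasSum_pow_add_div_factorial (a + b) 1
  have h2 := hasSum_pow_add_div_factorial (a + b) 2
  simp only [Finset.sum_range_succ, Finset.sum_range_zero] at h0 h1 h2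
  have h := ((h2.mul_right (-1 / (a + b) ^ 2 + 2 * a / (a + b) ^ 3)).add
    (h1.mul_right (1 / (a + b) - 2 * a / (a + b) ^ 2))).add (h0.mul_right (a / (a + b)))
  have hfun : (fun n : ℕ => ∑ p ∈ Finset.HasAntidiagonal.antidiagonal n,
      (1 + p.1 : ℝ) / (2 + p.1 + p.2) * (a ^ p.1 / (p.1 ! : ℝ) * (b ^ p.2 / (p.2 ! : ℝ)))) =
      fun n : ℕ => (a + b) ^ (n + 2) / ((n + 2)! : ℝ) * (-1 / (a + b) ^ 2 + 2 * a / (a + b) ^ 3) +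
        (a + b) ^ (n + 1) / ((n + 1)! : ℝ) * (1 / (a + b) - 2 * a / (a + b) ^ 2) +
        (a + b) ^ (n + 0) / ((n + 0)! : ℝ) * (a / (a + b)) := by
    funext n
    have hn : ∀ p ∈ Finset.HasAntidiagonal.antidiagonal n,
        (1 + p.1 : ℝ) / (2 + p.1 + p.2) * (a ^ p.1 / (p.1 ! : ℝ) * (b ^ p.2 / (p.2 ! : ℝ))) =
        (a ^ p.1 / (p.1 ! : ℝ) * (b ^ p.2 / (p.2 ! : ℝ)) +
          p.1 * (a ^ p.1 / (p.1 ! : ℝ) * (b ^ p.2 / (p.2 ! : ℝ)))) / (2 + n) := fun p hp => by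
      rw [Finset.HasAntidiagonal.mem_antidiagonal] at hp
      subst hp
      push_cast
      ring
    rw [Finset.sum_congr rfl hn, ← Finset.sum_div, Finset.sum_add_distrib,
      sum_antidiagonal_pow_div_factorial, sum_antidiagonal_mul_pow_div_factorial a b hs.ne',
      Nat.factorial_succ (n + 1), Nat.factorial_succ n]
    push_cast
    simp only [add_zero]
    generalize a + b = s at *
    field_simp
    ring
  rw [hfun, h.tsum_eq]
  simp only [Nat.factorial]
  push_cast
  ring

theorem dncBeta_one_one_second_moment (a b : ℝ) (ha : 0 ≤ a) (hb : 0 ≤ b) (hs : 0 < a + b) :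
    ∑' j : ℕ, ∑' k : ℕ, (Real.exp (-a) * a ^ j / (j ! : ℝ)) *
        (Real.exp (-b) * b ^ k / (k ! : ℝ)) * (asc (1 + j) 2 / asc (2 + j + k) 2) =
      Real.exp (-(a + b)) *
        ((Real.exp (a + b) - 1 - (a + b) - (a + b) ^ 2 / 2) *
            (-4 / (a + b) ^ 3 + 24 * a / (a + b) ^ 4 - 24 * a ^ 2 / (a + b) ^ 5) +
          (Real.exp (a + b) - 1 - (a + b)) *
            (2 / (a + b) ^ 2 - 16 * a / (a + b) ^ 3 + 18 * a ^ 2 / (a + b) ^ 4) +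
          (Real.exp (a + b) - 1) * (4 * a / (a + b) ^ 2 - 6 * a ^ 2 / (a + b) ^ 3) +
          Real.exp (a + b) * (a / (a + b)) ^ 2) := by
  simp only [asc_two]
  rw [tsum_tsum_poisson_mul a b ha hb
    (fun j k => (1 + j : ℝ) * (1 + j + 1) / ((2 + j + k) * (2 + j + k + 1)))
    (fun j k => by positivity)
    (fun j k => by
      rw [div_le_one (by positivity)]
      have := Nat.cast_nonneg (α := ℝ) k
      exact mul_le_mul (by linarith) (by linarith) (by positivity) (by positivity))]
  congr 1
  have h0 := hasSum_pow_add_div_factorial (a + b) 0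
  have h1 := hasSum_pow_add_div_factorial (a + b) 1
  have h2 := hasSum_pow_add_div_factorial (a + b) 2
  have h3 := hasSum_pow_add_div_factorial (a + b) 3
  simp only [Finset.sum_range_succ, Finset.sum_range_zero] at h0 h1 h2 h3
  have h := (((h3.mul_right
        (-4 / (a + b) ^ 3 + 24 * a / (a + b) ^ 4 - 24 * a ^ 2 / (a + b) ^ 5)).add
      (h2.mul_right (2 / (a + b) ^ 2 - 16 * a / (a + b) ^ 3 + 18 * a ^ 2 / (a + b) ^ 4))).add
      (h1.mul_right (4 * a / (a + b) ^ 2 - 6 * a ^ 2 / (a + b) ^ 3))).add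
      (h0.mul_right ((a / (a + b)) ^ 2))
  have hfun : (fun n : ℕ => ∑ p ∈ Finset.HasAntidiagonal.antidiagonal n,
      (1 + p.1 : ℝ) * (1 + p.1 + 1) / ((2 + p.1 + p.2) * (2 + p.1 + p.2 + 1)) *
        (a ^ p.1 / (p.1 ! : ℝ) * (b ^ p.2 / (p.2 ! : ℝ)))) =
      fun n : ℕ => (a + b) ^ (n + 3) / ((n + 3)! : ℝ) *
          (-4 / (a + b) ^ 3 + 24 * a / (a + b) ^ 4 - 24 * a ^ 2 / (a + b) ^ 5) +
        (a + b) ^ (n + 2) / ((n + 2)! : ℝ) *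
          (2 / (a + b) ^ 2 - 16 * a / (a + b) ^ 3 + 18 * a ^ 2 / (a + b) ^ 4) +
        (a + b) ^ (n + 1) / ((n + 1)! : ℝ) * (4 * a / (a + b) ^ 2 - 6 * a ^ 2 / (a + b) ^ 3) +
        (a + b) ^ (n + 0) / ((n + 0)! : ℝ) * (a / (a + b)) ^ 2 := by
    funext n
    have hn : ∀ p ∈ Finset.HasAntidiagonal.antidiagonal n,
        (1 + p.1 : ℝ) * (1 + p.1 + 1) / ((2 + p.1 + p.2) * (2 + p.1 + p.2 + 1)) *
          (a ^ p.1 / (p.1 ! : ℝ) * (b ^ p.2 / (p.2 ! : ℝ))) =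
        (2 * (a ^ p.1 / (p.1 ! : ℝ) * (b ^ p.2 / (p.2 ! : ℝ))) +
          4 * (p.1 * (a ^ p.1 / (p.1 ! : ℝ) * (b ^ p.2 / (p.2 ! : ℝ)))) +
          p.1 * (p.1 - 1) * (a ^ p.1 / (p.1 ! : ℝ) * (b ^ p.2 / (p.2 ! : ℝ)))) /
          ((2 + n) * (2 + n + 1)) := fun p hp => by
      rw [Finset.HasAntidiagonal.mem_antidiagonal] at hp
      subst hp
      push_cast
      rw [add_assoc (2 : ℝ)]
      ring
    rw [Finset.sum_congr rfl hn, ← Finset.sum_div, Finset.sum_add_distrib,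
      Finset.sum_add_distrib, ← Finset.mul_sum, ← Finset.mul_sum,
      sum_antidiagonal_pow_div_factorial, sum_antidiagonal_mul_pow_div_factorial a b hs.ne',
      sum_antidiagonal_mul_sub_one_mul_pow_div_factorial a b hs.ne',
      Nat.factorial_succ (n + 2), Nat.factorial_succ (n + 1), Nat.factorial_succ n]
    push_cast
    simp only [add_zero]
    generalize a + b = s at *
    have e2 : (n : ℝ) + 1 + 1 = 2 + n := by ring
    have e3 : (n : ℝ) + 2 + 1 = 3 + n := by ring
    have e3' : 2 + (n : ℝ) + 1 = 3 + n := by ring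
    rw [e2, e3, e3']
    field_simp
    ring
  rw [hfun, h.tsum_eq]
  simp only [Nat.factorial]
  push_cast
  ring

/-- Variance of the doubly non-central beta distribution with both shape parameters equal
to `1`: with `μ_r` the `r`-th moment about zero, `V = μ_2 − μ_1²` equals
`4/(λ⁺)² + [4λ1λ2/(λ⁺)⁵][(λ⁺−2)(λ⁺−8) − 2e^{−λ⁺/2}(λ⁺+8)]
 + [8(λ1−λ2)²/(λ⁺)⁶][(λ⁺)²e^{−λ⁺/2} − 2(1−e^{−λ⁺/2})(λ⁺+1−e^{−λ⁺/2})]`. -/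
theorem dncBeta_one_one_variance (lam1 lam2 : ℝ) (hl1 : 0 ≤ lam1) (hl2 : 0 ≤ lam2)
    (hlsum : 0 < lam1 + lam2) (mu : ℕ → ℝ)
    (hmu : ∀ r : ℕ, mu r = ∑' j : ℕ, ∑' k : ℕ,
      (Real.exp (-(lam1 / 2)) * (lam1 / 2) ^ j / (j ! : ℝ)) *
        (Real.exp (-(lam2 / 2)) * (lam2 / 2) ^ k / (k ! : ℝ)) *
        (asc (1 + j) r / asc (2 + j + k) r)) :
    mu 2 - (mu 1) ^ 2 =
      4 / (lam1 + lam2) ^ 2 +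
        (4 * lam1 * lam2 / (lam1 + lam2) ^ 5) *
          (((lam1 + lam2) - 2) * ((lam1 + lam2) - 8) -
            2 * Real.exp (-((lam1 + lam2) / 2)) * ((lam1 + lam2) + 8)) +
        (8 * (lam1 - lam2) ^ 2 / (lam1 + lam2) ^ 6) *
          ((lam1 + lam2) ^ 2 * Real.exp (-((lam1 + lam2) / 2)) -
            2 * (1 - Real.exp (-((lam1 + lam2) / 2))) *
              ((lam1 + lam2) + 1 - Real.exp (-((lam1 + lam2) / 2)))) := by
  have hs : 0 < lam1 / 2 + lam2 / 2 := by linarith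
  rw [hmu 1, hmu 2, dncBeta_one_one_first_moment _ _ (by linarith) (by linarith) hs,
    dncBeta_one_one_second_moment _ _ (by linarith) (by linarith) hs]
  obtain ⟨s, rfl⟩ : ∃ s, lam2 = 2 * s - lam1 := ⟨lam1 / 2 + lam2 / 2, by ring⟩
  have e1 : lam1 / 2 + (2 * s - lam1) / 2 = s := by ring
  have e2 : lam1 + (2 * s - lam1) = 2 * s := by ring
  have e3 : 2 * s / 2 = s := by ring
  rw [e1] at hs
  rw [e1, e2, e3, Real.exp_neg]
  have hE := (Real.exp_pos s).ne'
  field_simp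
  ring
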